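/- Let A be a finite bounded hoop. The following are equivalent: (i) there exists a bounded hoop homomorphism from A to the two-element bounded hoop 2; (ii) A is projective in the class of all finite bounded hoops, i.e., for all finite bounded hoops B and C, every bounded hoop homomorphism h : A → C and every surjective bounded hoop homomorphism g : B → C, there is a bounded hoop homomorphism f : A → B with g ∘ f = h. -/

import Mathlib

/-- A hoop: a commutative monoid `(α, ·, 1)` with an operation `→` satisfying
`x → x = 1`, divisibility `x·(x → y) = y·(y → x)`, and
`x → (y → z) = (x·y) → z`. -/
class Hoop (α : Type) where
  mul : α → α → α
  himp : α → α → α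
  one : α
  mul_comm : ∀ a b : α, mul a b = mul b a
  mul_assoc : ∀ a b c : α, mul (mul a b) c = mul a (mul b c)
  mul_one : ∀ a : α, mul a one = a
  himp_self : ∀ a : α, himp a a = one
  div : ∀ a b : α, mul a (himp a b) = mul b (himp b a)
  himp_himp : ∀ a b c : α, himp a (himp b c) = himp (mul a b) c

/-- A bounded hoop: a hoop with a least element `0` (i.e. `0 → x = 1`). -/
class BHoop (α : Type) extends Hoop α where
  zero : α
  zero_himp : ∀ a : α, himp zero a = one

/-- A bounded hoop homomorphism preserves `·`, `→`, `1` and `0`. -/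
def IsBHoopHom {α β : Type} [BHoop α] [BHoop β] (f : α → β) : Prop :=
  (∀ a b : α, f (Hoop.mul a b) = Hoop.mul (f a) (f b)) ∧
  (∀ a b : α, f (Hoop.himp a b) = Hoop.himp (f a) (f b)) ∧
  f Hoop.one = Hoop.one ∧ f BHoop.zero = BHoop.zero

/-- Negation in a bounded hoop: `¬x = x → 0`. -/
def BHoop.neg {α : Type} [BHoop α] (a : α) : α := Hoop.himp a BHoop.zero

/-- The two-element bounded hoop `2`, realized on `Bool`. -/
instance : BHoop Bool where
  mul := and
  himp x y := !x || y
  one := true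
  zero := false
  mul_comm := by decide
  mul_assoc := by decide
  mul_one := by decide
  himp_self := by decide
  div := by decide
  himp_himp := by decide
  zero_himp := by decide

namespace HoopAux

variable {α : Type} [Hoop α]

local infixl:70 "⋆" => Hoop.mul
local infixr:60 "⇝" => Hoop.himp
local notation "𝟙" => Hoop.one

theorem one_himp (x : α) : (𝟙 : α) ⇝ x = x := by
  have one_mul : ∀ a : α, 𝟙 ⋆ a = a := fun a => by rw [Hoop.mul_comm, Hoop.mul_one]
  have hq : ∀ q : α, (𝟙 : α) ⇝ q = q ⋆ (q ⇝ 𝟙) := fun q => by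
    rw [← Hoop.div, one_mul]
  have h2 : ∀ y z : α, (𝟙 : α) ⇝ (y ⇝ z) = y ⇝ z := fun y z => by
    rw [Hoop.himp_himp, one_mul]
  have h3 : x ⇝ (𝟙 ⇝ x) = 𝟙 := by
    rw [Hoop.himp_himp, Hoop.mul_one, Hoop.himp_self]
  have h4 : (𝟙 ⇝ x) ⇝ x = (x ⇝ 𝟙) ⇝ 𝟙 := by
    rw [hq x, Hoop.mul_comm, ← Hoop.himp_himp, Hoop.himp_self]
  have h5 : x = (𝟙 ⇝ x) ⋆ ((x ⇝ 𝟙) ⇝ 𝟙) := by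
    rw [← h4, ← Hoop.div, h3, Hoop.mul_one]
  have h6 : (x ⇝ 𝟙) = (x ⇝ 𝟙) ⋆ ((x ⇝ 𝟙) ⇝ 𝟙) := by
    rw [← hq, h2]
  rw [hq x, Hoop.mul_assoc, ← h6, ← hq] at h5
  exact h5.symm

theorem himp_one (x : α) : x ⇝ (𝟙 : α) = 𝟙 := by
  have one_mul : ∀ a : α, 𝟙 ⋆ a = a := fun a => by rw [Hoop.mul_comm, Hoop.mul_one]
  have h : x = x ⋆ (x ⇝ 𝟙) := by
    rw [← Hoop.div, one_mul, one_himp]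
  calc x ⇝ (𝟙 : α) = (x ⋆ (x ⇝ 𝟙)) ⇝ 𝟙 := by rw [← h]
    _ = 𝟙 := by rw [Hoop.mul_comm, ← Hoop.himp_himp, Hoop.himp_self]

/-- The hoop order. -/
def le (a b : α) : Prop := a ⇝ b = 𝟙

theorem le_refl (a : α) : le a a := Hoop.himp_self a

theorem le_antisymm {a b : α} (h : le a b) (h' : le b a) : a = b := by
  have := Hoop.div a b
  rwa [show a ⇝ b = 𝟙 from h, show b ⇝ a = 𝟙 from h', Hoop.mul_one, Hoop.mul_one] at this

theorem le_trans {a b c : α} (h : le a b) (h' : le b c) : le a c := by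
  have h1 : a = (b ⇝ a) ⋆ b := by
    rw [Hoop.mul_comm, ← Hoop.div, show a ⇝ b = 𝟙 from h, Hoop.mul_one]
  unfold le
  rw [h1, ← Hoop.himp_himp, show b ⇝ c = 𝟙 from h', himp_one]

theorem res {a b c : α} : le (a ⋆ b) c ↔ le a (b ⇝ c) := by
  unfold le; rw [Hoop.himp_himp]

theorem mul_le_right (a b : α) : le (a ⋆ b) b := by
  rw [res, Hoop.himp_self]; exact himp_one a

theorem mul_le_left (a b : α) : le (a ⋆ b) a := by
  rw [Hoop.mul_comm]; exact mul_le_right b a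

theorem mul_mono_left {a b : α} (c : α) (h : le a b) : le (a ⋆ c) (b ⋆ c) :=
  res.2 (le_trans h (res.1 (le_refl _)))

theorem mul_mono {a b c d : α} (h : le a b) (h' : le c d) : le (a ⋆ c) (b ⋆ d) := by
  refine le_trans (mul_mono_left c h) ?_
  rw [Hoop.mul_comm b c, Hoop.mul_comm b d]
  exact mul_mono_left b h'

theorem mp (a b : α) : le ((a ⇝ b) ⋆ a) b := res.2 (le_refl _)

theorem himp_mono {a b : α} (c : α) (h : le a b) : le (c ⇝ a) (c ⇝ b) :=
  res.1 (le_trans (mp c a) h)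

theorem himp_anti {a b : α} (c : α) (h : le a b) : le (b ⇝ c) (a ⇝ c) := by
  refine res.1 (le_trans ?_ (mp b c))
  exact mul_mono (le_refl _) h

theorem le_himp (a b : α) : le b (a ⇝ b) := res.1 (mul_le_left b a)

theorem inf_eq {a b : α} (h : le b a) : a ⋆ (a ⇝ b) = b := by
  rw [Hoop.div, show b ⇝ a = 𝟙 from h, Hoop.mul_one]

theorem himp_inf (a b : α) : a ⇝ (a ⋆ (a ⇝ b)) = a ⇝ b := by
  apply le_antisymm
  · apply himp_mono
    rw [Hoop.mul_comm]; exact mp a b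
  · apply res.1
    rw [Hoop.mul_comm]; exact le_refl _

theorem himp_idem {e : α} (he : e ⋆ e = e) (x : α) : e ⇝ (e ⇝ x) = e ⇝ x := by
  rw [Hoop.himp_himp, he]

theorem key1 {e : α} (he : e ⋆ e = e) (x : α) :
    (e ⇝ x) ⇝ ((e ⇝ x) ⇝ x) = (e ⇝ x) ⇝ x := by
  obtain ⟨y, hy⟩ : ∃ y, y = e ⇝ x := ⟨_, rfl⟩
  obtain ⟨r, hr⟩ : ∃ r, r = y ⇝ x := ⟨_, rfl⟩
  have hey : e ⇝ y = y := by rw [hy, himp_idem he]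
  have her : le e r := by
    rw [hr]; apply res.1; rw [Hoop.mul_comm, hy]; exact mp e x
  have hxy : le x y := by rw [hy]; exact le_himp e x
  have hyr : y ⋆ r = x := by rw [hr]; exact inf_eq hxy
  have hry : r ⇝ y = y := by
    apply le_antisymm _ (le_himp r y)
    have := himp_anti y her
    rwa [hey] at this
  have hinf : y ⋆ (y ⇝ r) = x := by
    rw [Hoop.div, hry, Hoop.mul_comm, hyr]
  rw [← hy, ← hr, ← himp_inf, hinf, ← hr]

/-- Elements fixed by `e → ·` are closed under the product. -/
theorem key2 {e : α} (he : e ⋆ e = e) {u v : α} (hu : e ⇝ u = u) (hv : e ⇝ v = v) :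
    e ⇝ (u ⋆ v) = u ⋆ v := by
  apply le_antisymm _ (le_himp _ _)
  have h1 : le (e ⇝ (u ⋆ v)) u := by
    have := himp_mono e (mul_le_left u v)
    rwa [hu] at this
  have h2 : le (e ⇝ (u ⋆ v)) v := by
    have := himp_mono e (mul_le_right u v)
    rwa [hv] at this
  have h3 := res.1 (mul_mono h1 h2)
  unfold le at h3 ⊢
  rwa [key1 he] at h3

theorem inf_idem {e : α} (he : e ⋆ e = e) (x : α) : e ⋆ (e ⇝ x) = e ⋆ x := by
  apply le_antisymm
  · rw [← he, Hoop.mul_assoc, he]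
    apply mul_mono (le_refl e)
    rw [Hoop.mul_comm]; exact mp e x
  · exact mul_mono (le_refl e) (le_himp e x)

theorem himp_mul_idem {e : α} (he : e ⋆ e = e) (x : α) : e ⇝ (e ⋆ x) = e ⇝ x := by
  rw [← inf_idem he, himp_inf]

theorem himp_mul {e : α} (he : e ⋆ e = e) (x y : α) :
    e ⇝ (x ⋆ y) = (e ⇝ x) ⋆ (e ⇝ y) := by
  have h := key2 he (himp_idem he x) (himp_idem he y)
  rw [← h, ← himp_mul_idem he (x ⋆ y), ← himp_mul_idem he ((e ⇝ x) ⋆ (e ⇝ y)),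
    ← Hoop.mul_assoc, ← Hoop.mul_assoc, inf_idem he, Hoop.mul_comm (e ⋆ x) (e ⇝ y)]
  congr 1
  rw [Hoop.mul_comm e x, ← Hoop.mul_assoc, Hoop.mul_comm (e ⇝ y) x,
    Hoop.mul_assoc, Hoop.mul_assoc, Hoop.mul_comm (e ⇝ y) e, inf_idem he]

theorem himp_dist {e : α} (he : e ⋆ e = e) (x y : α) :
    e ⇝ (x ⇝ y) = (e ⇝ x) ⇝ (e ⇝ y) := by
  rw [Hoop.himp_himp, Hoop.himp_himp, Hoop.mul_comm (e ⇝ x) e, inf_idem he]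

theorem exists_min {B C : Type} [BHoop B] [BHoop C] [Finite B] (g : B → C)
    (hg : IsBHoopHom g) : ∃ e : B, g e = 𝟙 ∧ ∀ t, g t = 𝟙 → le e t := by
  have key : ∀ s : Finset B, ∃ e : B, g e = 𝟙 ∧ ∀ t ∈ s, g t = 𝟙 → le e t := by
    classical
    intro s
    induction s using Finset.induction_on with
    | empty => exact ⟨𝟙, hg.2.2.1, by simp⟩
    | insert a s ha ih =>
      obtain ⟨e, he, hs⟩ := ih
      by_cases hga : g a = 𝟙
      · refine ⟨e ⋆ a, by rw [hg.1, he, hga, Hoop.mul_one], ?_⟩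
        intro t ht hgt
        rcases Finset.mem_insert.1 ht with rfl | ht
        · exact mul_le_right _ _
        · exact le_trans (mul_le_left _ _) (hs t ht hgt)
      · refine ⟨e, he, ?_⟩
        intro t ht hgt
        rcases Finset.mem_insert.1 ht with rfl | ht
        · exact absurd hgt hga
        · exact hs t ht hgt
  cases nonempty_fintype B
  obtain ⟨e, he, h⟩ := key Finset.univ
  exact ⟨e, he, fun t => h t (Finset.mem_univ t)⟩

theorem lift {A B C : Type} [BHoop A] [BHoop B] [BHoop C] [Finite B]
    (φ : A → Bool) (hφ : IsBHoopHom φ) (h : A → C) (g : B → C)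
    (hh : IsBHoopHom h) (hg : IsBHoopHom g) (hs : Function.Surjective g) :
    ∃ f : A → B, IsBHoopHom f ∧ g ∘ f = h := by
  obtain ⟨e, hge, hmin⟩ := exists_min g hg
  have he : e ⋆ e = e := le_antisymm (mul_le_left e e)
    (hmin _ (by rw [hg.1, hge, Hoop.mul_one]))
  have hcong : ∀ x y : B, g x = g y → e ⇝ x = e ⇝ y := by
    have : ∀ x y : B, g x = g y → le (e ⇝ x) (e ⇝ y) := by
      intro x y hxy
      have h1 : le e (x ⇝ y) := hmin _ (by rw [hg.2.1, hxy, Hoop.himp_self])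
      have h2 := himp_dist he x y
      rw [show e ⇝ (x ⇝ y) = 𝟙 from h1] at h2
      exact h2.symm
    exact fun x y hxy => le_antisymm (this x y hxy) (this y x hxy.symm)
  choose s hs using hs
  obtain ⟨f₀, hf₀⟩ : ∃ f₀ : A → B, ∀ a, f₀ a = e ⇝ s (h a) := ⟨_, fun _ => rfl⟩
  have fmul : ∀ a b, f₀ (a ⋆ b) = f₀ a ⋆ f₀ b := by
    intro a b
    rw [hf₀, hf₀, hf₀, ← himp_mul he]
    apply hcong
    rw [hs, hg.1, hs, hs, hh.1]
  have fimp : ∀ a b, f₀ (a ⇝ b) = f₀ a ⇝ f₀ b := by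
    intro a b
    rw [hf₀, hf₀, hf₀, ← himp_dist he]
    apply hcong
    rw [hs, hg.2.1, hs, hs, hh.2.1]
  have fone : f₀ 𝟙 = 𝟙 := by
    rw [hf₀, ← himp_one e]
    apply hcong
    rw [hs, hh.2.2.1, hg.2.2.1]
  obtain ⟨z, hz⟩ : ∃ z : B, z = e ⇝ BHoop.zero := ⟨_, rfl⟩
  have fzero : f₀ BHoop.zero = z := by
    rw [hf₀, hz]
    apply hcong
    rw [hs, hh.2.2.2, hg.2.2.2]
  have zero_le : ∀ x : B, le BHoop.zero x := BHoop.zero_himp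
  have zz : (BHoop.zero : B) ⋆ BHoop.zero = BHoop.zero :=
    le_antisymm (mul_le_left _ _) (zero_le _)
  have hzz : z ⋆ z = z := by rw [hz, ← himp_mul he, zz]
  obtain ⟨d, hd⟩ : ∃ d : B, d = z ⇝ BHoop.zero := ⟨_, rfl⟩
  have hdd : d ⋆ d = d := by rw [hd, ← himp_mul hzz, zz]
  have hed : le e d := by
    rw [hd]; apply res.1; rw [Hoop.mul_comm, hz]; exact mp _ _
  have hgd : g d = 𝟙 := by
    have := hg.2.1 e d
    rw [show e ⇝ d = 𝟙 from hed, hge, hg.2.2.1, one_himp] at this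
    exact this.symm
  have hzd : z ⋆ d = BHoop.zero := by rw [hd]; exact inf_eq (zero_le z)
  have hdf : ∀ a, d ⇝ f₀ a = f₀ a := by
    intro a
    apply le_antisymm _ (le_himp _ _)
    have := himp_anti (f₀ a) hed
    rwa [hf₀ a, himp_idem he, ← hf₀ a] at this
  have hzf : ∀ a, le z (f₀ a) := by
    intro a; rw [hz, hf₀]; exact himp_mono e (zero_le _)
  have hfz : ∀ a, f₀ a ⋆ z = z := by
    intro a
    apply le_antisymm (mul_le_right _ _)
    have := mul_mono_left z (hzf a)
    rwa [hzz] at this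
  have hfd : ∀ a, f₀ a ⇝ d = d := by
    intro a; rw [hd, Hoop.himp_himp, hfz]
  have hgf : ∀ a, g (f₀ a) = h a := by
    intro a; rw [hf₀, hg.2.1, hge, one_himp, hs]
  obtain ⟨f, hf⟩ : ∃ f : A → B, ∀ a, f a = if φ a = true then f₀ a else f₀ a ⋆ d :=
    ⟨_, fun _ => rfl⟩
  have ft : ∀ a, φ a = true → f a = f₀ a := fun a ha => by rw [hf, if_pos ha]
  have ff : ∀ a, φ a = false → f a = f₀ a ⋆ d := fun a ha => by rw [hf, if_neg (by simp [ha])]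
  have hφm : ∀ a b, φ (a ⋆ b) = (φ a && φ b) := hφ.1
  have hφi : ∀ a b, φ (a ⇝ b) = (!φ a || φ b) := hφ.2.1
  have hφ1 : φ 𝟙 = true := hφ.2.2.1
  have hφ0 : φ BHoop.zero = false := hφ.2.2.2
  refine ⟨f, ⟨?_, ?_, ?_, ?_⟩, ?_⟩
  · intro a b
    cases ha : φ a <;> cases hb : φ b
    · rw [ff a ha, ff b hb, ff _ (by rw [hφm, ha, hb]; rfl), fmul, Hoop.mul_assoc (f₀ a) d,
        ← Hoop.mul_assoc d, Hoop.mul_comm d (f₀ b), Hoop.mul_assoc (f₀ b) d d, hdd,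
        Hoop.mul_assoc]
    · rw [ff a ha, ft b hb, ff _ (by rw [hφm, ha, hb]; rfl), fmul, Hoop.mul_assoc,
        Hoop.mul_assoc, Hoop.mul_comm (f₀ b) d]
    · rw [ft a ha, ff b hb, ff _ (by rw [hφm, ha, hb]; rfl), fmul, Hoop.mul_assoc]
    · rw [ft a ha, ft b hb, ft _ (by rw [hφm, ha, hb]; rfl), fmul]
  · intro a b
    cases ha : φ a <;> cases hb : φ b
    · rw [ff a ha, ff b hb, ft _ (by rw [hφi, ha, hb]; rfl), fimp, ← Hoop.himp_himp,
        Hoop.mul_comm (f₀ b) d, himp_mul_idem hdd, hdf]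
    · rw [ff a ha, ft b hb, ft _ (by rw [hφi, ha, hb]; rfl), fimp, ← Hoop.himp_himp, hdf]
    · rw [ft a ha, ff b hb, ff _ (by rw [hφi, ha, hb]; rfl)]
      apply le_antisymm
      · apply res.1
        rw [Hoop.mul_assoc, Hoop.mul_comm d, ← Hoop.mul_assoc, fimp]
        exact mul_mono_left d (mp _ _)
      · have h1 : le (f₀ a ⇝ (f₀ b ⋆ d)) d := by
          have := himp_mono (f₀ a) (mul_le_right (f₀ b) d)
          rwa [hfd] at this
        have h2 : le (f₀ a ⇝ (f₀ b ⋆ d)) (f₀ (a ⇝ b)) := by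
          rw [fimp]; exact himp_mono (f₀ a) (mul_le_left (f₀ b) d)
        have h3 := himp_mono d h2
        rw [hdf] at h3
        have h4 := mul_mono_left d h3
        rwa [Hoop.mul_comm, inf_eq h1] at h4
    · rw [ft a ha, ft b hb, ft _ (by rw [hφi, ha, hb]; rfl), fimp]
  · rw [ft _ hφ1, fone]
  · rw [ff _ hφ0, fzero, hzd]
  · funext a
    show g (f a) = h a
    cases ha : φ a
    · rw [ff a ha, hg.1, hgd, Hoop.mul_one, hgf]
    · rw [ft a ha, hgf]

/-- The one-element bounded hoop. -/
def trivialHoop : BHoop Unit where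
  mul _ _ := ()
  himp _ _ := ()
  one := ()
  zero := ()
  mul_comm _ _ := rfl
  mul_assoc _ _ _ := rfl
  mul_one _ := rfl
  himp_self _ := rfl
  div _ _ := rfl
  himp_himp _ _ _ := rfl
  zero_himp _ := rfl

end HoopAux

/-- A finite bounded hoop is projective in the class of all finite bounded
hoops if and only if it admits a bounded hoop homomorphism onto the
two-element bounded hoop `2`. -/
theorem finite_bounded_hoop_projective_iff_hom_to_two (A : Type) [BHoop A]
    [Finite A] :
    (∃ φ : A → Bool, IsBHoopHom φ) ↔
    (∀ (B C : Type) [BHoop B] [BHoop C] [Finite B] [Finite C],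
      ∀ (h : A → C) (g : B → C), IsBHoopHom h → IsBHoopHom g →
        Function.Surjective g →
          ∃ f : A → B, IsBHoopHom f ∧ g ∘ f = h) := by
  constructor
  · rintro ⟨φ, hφ⟩ B C _ _ _ _ h g hh hg hs
    exact HoopAux.lift φ hφ h g hh hg hs
  · intro H
    let _ := HoopAux.trivialHoop
    obtain ⟨f, hf, -⟩ := H Bool Unit (fun _ => ()) (fun _ => ())
      ⟨fun _ _ => rfl, fun _ _ => rfl, rfl, rfl⟩ ⟨fun _ _ => rfl, fun _ _ => rfl, rfl, rfl⟩
      (fun _ => ⟨true, rfl⟩)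
    exact ⟨f, hf⟩
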